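/- Let n ≥ 4 be even and let f : Fin n × Fin n → Fin 3 be a configuration that is symmetric of the second type or almost symmetric of the second type, with largest corner D and second largest corner A. Suppose the robot of f on side DA closest to A is r_1, at node (n-x, 0) (the x-th node from A, 1-indexed), and the robot of f on side AB closest to A is r_2, at node (n-1, y-1) (the y-th node from A), with 2 ≤ y ≤ x. Let f' be obtained from f by moving r_2 to (n-1, y-2), or moving r_1 to (n-x+1, 0), or both. Then f' is not partitive: f' ≠ f' ∘ σ for every σ ∈ {h, v, r1, r1⁻¹, r2}. -/

import Mathlib

/-! ## Basic definitions: configurations on the n×n grid, reading sequences,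
symmetries of the square, and the configuration classes from the paper. -/

theorem sidePos {n : ℕ} (k : Fin (n * n)) : 0 < n := by
  rcases Nat.eq_zero_or_pos n with h | h
  · exact absurd k.2 (by simp [h])
  · exact h

/-- For an index `k = n*j + i` (column-major reading), the row `i = k % n`. -/
def rowOf {n : ℕ} (k : Fin (n * n)) : Fin n :=
  ⟨k.val % n, Nat.mod_lt _ (sidePos k)⟩

/-- For an index `k = n*j + i` (column-major reading), the column `j = k / n`. -/
def colOf {n : ℕ} (k : Fin (n * n)) : Fin n :=
  ⟨k.val / n, (Nat.div_lt_iff_lt_mul (sidePos k)).2 k.2⟩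

/-- λ_DA(n·j+i) = f(i,j) -/
def lamDA {n : ℕ} (f : Fin n × Fin n → Fin 3) : Fin (n * n) → Fin 3 :=
  fun k => f (rowOf k, colOf k)

/-- λ_DC(n·i+j) = f(i,j) -/
def lamDC {n : ℕ} (f : Fin n × Fin n → Fin 3) : Fin (n * n) → Fin 3 :=
  fun k => f (colOf k, rowOf k)

/-- λ_AD(n·j+i) = f(n-1-i,j) -/
def lamAD {n : ℕ} (f : Fin n × Fin n → Fin 3) : Fin (n * n) → Fin 3 :=
  fun k => f ((rowOf k).rev, colOf k)

/-- λ_AB(n·i+j) = f(n-1-i,j) -/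
def lamAB {n : ℕ} (f : Fin n × Fin n → Fin 3) : Fin (n * n) → Fin 3 :=
  fun k => f ((colOf k).rev, rowOf k)

/-- λ_BA(n·j+i) = f(n-1-i,n-1-j) -/
def lamBA {n : ℕ} (f : Fin n × Fin n → Fin 3) : Fin (n * n) → Fin 3 :=
  fun k => f ((rowOf k).rev, (colOf k).rev)

/-- λ_BC(n·i+j) = f(n-1-i,n-1-j) -/
def lamBC {n : ℕ} (f : Fin n × Fin n → Fin 3) : Fin (n * n) → Fin 3 :=
  fun k => f ((colOf k).rev, (rowOf k).rev)

/-- λ_CB(n·j+i) = f(i,n-1-j) -/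
def lamCB {n : ℕ} (f : Fin n × Fin n → Fin 3) : Fin (n * n) → Fin 3 :=
  fun k => f (rowOf k, (colOf k).rev)

/-- λ_CD(n·i+j) = f(i,n-1-j) -/
def lamCD {n : ℕ} (f : Fin n × Fin n → Fin 3) : Fin (n * n) → Fin 3 :=
  fun k => f (colOf k, (rowOf k).rev)

/-- horizontal reflection h(i,j) = (n-1-i, j) -/
def symH {n : ℕ} (p : Fin n × Fin n) : Fin n × Fin n := (p.1.rev, p.2)

/-- vertical reflection v(i,j) = (i, n-1-j) -/
def symV {n : ℕ} (p : Fin n × Fin n) : Fin n × Fin n := (p.1, p.2.rev)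

/-- half turn r2(i,j) = (n-1-i, n-1-j) -/
def symR2 {n : ℕ} (p : Fin n × Fin n) : Fin n × Fin n := (p.1.rev, p.2.rev)

/-- quarter turn r1(i,j) = (j, n-1-i) -/
def symR1 {n : ℕ} (p : Fin n × Fin n) : Fin n × Fin n := (p.2, p.1.rev)

/-- quarter turn r1⁻¹(i,j) = (n-1-j, i) -/
def symR1inv {n : ℕ} (p : Fin n × Fin n) : Fin n × Fin n := (p.2.rev, p.1)

/-- diagonal reflection d(i,j) = (j, i) -/
def symD {n : ℕ} (p : Fin n × Fin n) : Fin n × Fin n := (p.2, p.1)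

/-- antidiagonal reflection a(i,j) = (n-1-j, n-1-i) -/
def symA {n : ℕ} (p : Fin n × Fin n) : Fin n × Fin n := (p.2.rev, p.1.rev)

/-- `f` is asymmetric: not invariant under any non-identity symmetry of the square. -/
def Asymmetric {n : ℕ} (f : Fin n × Fin n → Fin 3) : Prop :=
  ∀ σ ∈ [symH (n := n), symV, symR2, symR1, symR1inv, symD, symA], f ≠ f ∘ σ

/-- `f` is partitive: invariant under one of h, v, r1, r1⁻¹, r2. -/
def PartitiveSq {n : ℕ} (f : Fin n × Fin n → Fin 3) : Prop :=
  ∃ σ ∈ [symH (n := n), symV, symR1, symR1inv, symR2], f = f ∘ σ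

/-- all four corner nodes are empty -/
def CornersEmpty {n : ℕ} (f : Fin n × Fin n → Fin 3) : Prop :=
  ∀ p : Fin n × Fin n, (p.1.val = 0 ∨ p.1.val = n - 1) → (p.2.val = 0 ∨ p.2.val = n - 1) → f p = 0

/-- `f` takes no value 2 (no multiplicities) -/
def NoMult {n : ℕ} (f : Fin n × Fin n → Fin 3) : Prop := ∀ p, f p ≠ 2

/-- λ_DA is lexicographically strictly greater than the other seven reading sequences -/
def DAStrictMax {n : ℕ} (f : Fin n × Fin n → Fin 3) : Prop :=
  ∀ s ∈ [lamDC f, lamAD f, lamAB f, lamBA f, lamBC f, lamCB f, lamCD f],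
    toLex s < toLex (lamDA f)

/-- λ_DA is lexicographically largest among the eight reading sequences -/
def DAMax {n : ℕ} (f : Fin n × Fin n → Fin 3) : Prop :=
  ∀ s ∈ [lamDC f, lamAD f, lamAB f, lamBA f, lamBC f, lamCB f, lamCD f],
    toLex s ≤ toLex (lamDA f)

/-- replace the first nonzero entry of a sequence by 0 -/
def zeroFirst {N : ℕ} (s : Fin N → Fin 3) : Fin N → Fin 3 :=
  fun k => if s k ≠ 0 ∧ ∀ j < k, s j = 0 then 0 else s k

/-- `s` attains the lexicographic maximum of the four corner sequences
{λ_AD, λ_AB, λ_CB, λ_CD} of `f`. -/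
def AttainsMax4 {n : ℕ} (f : Fin n × Fin n → Fin 3) (s : Fin (n * n) → Fin 3) : Prop :=
  ∀ t ∈ [lamAD f, lamAB f, lamCB f, lamCD f], toLex t ≤ toLex s

/-- A is the second largest corner: the max of the four corner sequences is attained
by λ_AD or λ_AB -/
def SecondIsA {n : ℕ} (f : Fin n × Fin n → Fin 3) : Prop :=
  AttainsMax4 f (lamAD f) ∨ AttainsMax4 f (lamAB f)

/-- C is the second largest corner -/
def SecondIsC {n : ℕ} (f : Fin n × Fin n → Fin 3) : Prop :=
  AttainsMax4 f (lamCB f) ∨ AttainsMax4 f (lamCD f)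

/-- the row i = 0 (side DC) contains at least one robot -/
def Row0HasRobot {n : ℕ} (f : Fin n × Fin n → Fin 3) : Prop :=
  ∃ p : Fin n × Fin n, p.1.val = 0 ∧ f p ≠ 0

/-- almost symmetric of the first type, largest corner D -/
def AlmostSym1 {n : ℕ} (f : Fin n × Fin n → Fin 3) : Prop :=
  CornersEmpty f ∧ NoMult f ∧ Asymmetric f ∧ DAStrictMax f ∧ Row0HasRobot f ∧
    zeroFirst (lamDA f) = zeroFirst (lamDC f)

/-- almost symmetric of the second type, largest corner D (second largest corner A or C) -/
def AlmostSym2 {n : ℕ} (f : Fin n × Fin n → Fin 3) : Prop :=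
  CornersEmpty f ∧ NoMult f ∧ Asymmetric f ∧ DAStrictMax f ∧
    ((SecondIsA f ∧ zeroFirst (lamAD f) = zeroFirst (lamAB f)) ∨
     (SecondIsC f ∧ zeroFirst (lamCB f) = zeroFirst (lamCD f)))

/-- almost symmetric of the second type with largest corner D and second largest corner A -/
def AlmostSym2A {n : ℕ} (f : Fin n × Fin n → Fin 3) : Prop :=
  CornersEmpty f ∧ NoMult f ∧ Asymmetric f ∧ DAStrictMax f ∧ SecondIsA f ∧
    zeroFirst (lamAD f) = zeroFirst (lamAB f)

/-- symmetric of the first type, largest corner D -/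
def SymFirstType {n : ℕ} (f : Fin n × Fin n → Fin 3) : Prop :=
  CornersEmpty f ∧ f = f ∘ symD ∧ ¬ PartitiveSq f ∧ DAMax f

/-- symmetric of the second type, largest corner D -/
def SymSecondType {n : ℕ} (f : Fin n × Fin n → Fin 3) : Prop :=
  CornersEmpty f ∧ f = f ∘ symA ∧ ¬ PartitiveSq f ∧ DAMax f

/-- symmetric of the second type, largest corner D and second largest corner A -/
def SymSecondTypeA {n : ℕ} (f : Fin n × Fin n → Fin 3) : Prop :=
  SymSecondType f ∧ SecondIsA f

/-- purely asymmetric with largest corner D -/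
def PurelyAsym {n : ℕ} (f : Fin n × Fin n → Fin 3) : Prop :=
  CornersEmpty f ∧ Asymmetric f ∧ DAStrictMax f ∧ ¬ AlmostSym1 f ∧ ¬ AlmostSym2 f

/-- position of a node in the λ_DA reading order -/
def idxDA {n : ℕ} (p : Fin n × Fin n) : ℕ := n * p.2.val + p.1.val

/-- `u` is the first occupied node of `f` in λ_DA-order -/
def FirstRobot {n : ℕ} (f : Fin n × Fin n → Fin 3) (u : Fin n × Fin n) : Prop :=
  f u ≠ 0 ∧ ∀ p, f p ≠ 0 → idxDA u ≤ idxDA p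

/-- `u₂` is the second occupied node of `f` in λ_DA-order (after `u₁`) -/
def SecondRobot {n : ℕ} (f : Fin n × Fin n → Fin 3) (u₁ u₂ : Fin n × Fin n) : Prop :=
  f u₂ ≠ 0 ∧ u₂ ≠ u₁ ∧ ∀ p, f p ≠ 0 → p ≠ u₁ → idxDA u₂ ≤ idxDA p

/-- destination of the one-step movement rule toward D for a robot at node `p = (i,j)`:
columnwise to (i-1,j) if j = 0, or (j = 1 and i > 1), or (i = n-1 and j+1 ≤ n/2);
otherwise rowwise to (i, j-1). -/
def destD {n : ℕ} (p : Fin n × Fin n) : Fin n × Fin n :=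
  if p.2.val = 0 ∨ (p.2.val = 1 ∧ 1 < p.1.val) ∨ (p.1.val = n - 1 ∧ p.2.val + 1 ≤ n / 2) then
    (⟨p.1.val - 1, lt_of_le_of_lt (Nat.sub_le _ _) p.1.2⟩, p.2)
  else
    (p.1, ⟨p.2.val - 1, lt_of_le_of_lt (Nat.sub_le _ _) p.2.2⟩)

/-- the configuration after a robot moves from node `u` to node `w` -/
def moveCfg {n : ℕ} (f : Fin n × Fin n → Fin 3) (u w : Fin n × Fin n) :
    Fin n × Fin n → Fin 3 :=
  fun p => if p = u then f u - 1 else if p = w then f w + 1 else f p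

theorem lex_zero_aux {N : ℕ} (s t : Fin N → Fin 3) (h : toLex t ≤ toLex s) (k : Fin N)
    (hs : ∀ j ≤ k, s j = 0) : t k = 0 := by
  by_contra hk
  rcases lt_or_eq_of_le h with h | h
  · obtain ⟨i, hi, hlt⟩ := h
    simp only [Pi.toLex_apply] at hi hlt
    have hik : ¬ i ≤ k := by
      intro hik
      rw [hs i hik] at hlt
      exact absurd hlt (Fin.not_lt_zero _)
    have := hi k (not_le.mp hik)
    rw [hs k le_rfl] at this
    exact hk this
  · have h' : t = s := toLex.injective h
    rw [h', hs k le_rfl] at hk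
    exact hk rfl

theorem core_aux (n x : ℕ) (hx2 : 2 ≤ x) (hxn : x < n) (F F' : ℕ → ℕ → Prop)
    (hA : ∀ i j, i < n → j < n → F i j → F (n - 1 - j) (n - 1 - i))
    (h3 : ∀ j, j < x - 1 → ¬ F 0 (n - 1 - j))
    (hr1c : ∀ i, i < n → n - x < i → ¬ F i 0)
    (hr1 : F (n - x) 0)
    (B1 B2 : Prop) (hB : B1 ∨ B2)
    (hB1 : B1 → F' (n - x + 1) 0) (hB2 : B2 → F' (n - 1) (x - 2))
    (hsame : ∀ i j, i < n → j < n → ¬ (B1 ∧ j = 0 ∧ (i = n - x ∨ i = n - x + 1)) →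
      ¬ (B2 ∧ i = n - 1 ∧ (j = x - 1 ∨ j = x - 2)) → (F' i j ↔ F i j)) :
    (¬ ∀ i j, i < n → j < n → (F' i j ↔ F' (n - 1 - i) j)) ∧
    (¬ ∀ i j, i < n → j < n → (F' i j ↔ F' i (n - 1 - j))) ∧
    (¬ ∀ i j, i < n → j < n → (F' i j ↔ F' (n - 1 - i) (n - 1 - j))) ∧
    (¬ ∀ i j, i < n → j < n → (F' i j ↔ F' j (n - 1 - i))) ∧
    (¬ ∀ i j, i < n → j < n → (F' i j ↔ F' (n - 1 - j) i)) := by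
  have hA' : ∀ i j i' j', i + j' = n - 1 → i' + j = n - 1 → (F i j ↔ F i' j') := by
    intro i j i' j' h1 h2
    have e1 : n - 1 - i = j' := by omega
    have e2 : n - 1 - j = i' := by omega
    have e3 : n - 1 - i' = j := by omega
    have e4 : n - 1 - j' = i := by omega
    constructor
    · intro h
      have := hA i j (by omega) (by omega) h
      rwa [e1, e2] at this
    · intro h
      have := hA i' j' (by omega) (by omega) h
      rwa [e3, e4] at this
  -- the two entries next to `C` that are empty
  have c1 : ¬ F 0 (n + 1 - x) := by
    have := h3 (x - 2) (by omega)
    rwa [show n - 1 - (x - 2) = n + 1 - x by omega] at this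
  have c2 : ¬ F (x - 2) (n - 1) := by
    rwa [hA' (x - 2) (n - 1) 0 (n + 1 - x) (by omega) (by omega)]
  have c1' : ¬ F' 0 (n + 1 - x) := by
    rwa [hsame 0 (n + 1 - x) (by omega) (by omega) (by omega) (by omega)]
  have c2' : ¬ F' (x - 2) (n - 1) := by
    rwa [hsame (x - 2) (n - 1) (by omega) (by omega) (by omega) (by omega)]
  have row0 : ∀ j, 0 < j → j < n → (F' 0 j ↔ F 0 j) := fun j h0 hj =>
    hsame 0 j (by omega) hj (by omega) (by omega)
  have col1 : ∀ i, i < n - 1 → (F' i (n - 1) ↔ F i (n - 1)) := fun i hi =>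
    hsame i (n - 1) (by omega) (by omega) (by omega) (by omega)
  have hr2 : F (n - 1) (x - 1) := by
    rwa [hA' (n - 1) (x - 1) (n - x) 0 (by omega) (by omega)]
  have corner : ¬ F' 0 0 → ¬ F 0 0 := by
    rw [hsame 0 0 (by omega) (by omega) (by omega) (by omega)]; exact id
  refine ⟨?_, ?_, ?_, ?_, ?_⟩
  · intro H
    have H' : ∀ i j i', i + i' = n - 1 → j < n → (F' i j ↔ F' i' j) := by
      intro i j i' h1 h2
      rw [H i j (by omega) h2, show n - 1 - i = i' by omega]
    have hn2 : ¬ B2 := by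
      intro b
      have h := hB2 b
      rw [H' (n - 1) (x - 2) 0 (by omega) (by omega),
        hsame 0 (x - 2) (by omega) (by omega) (by omega) (by omega),
        hA' 0 (x - 2) (n + 1 - x) (n - 1) (by omega) (by omega),
        ← hsame (n + 1 - x) (n - 1) (by omega) (by omega) (by omega) (by omega),
        H' (n + 1 - x) (n - 1) (x - 2) (by omega) (by omega)] at h
      exact c2' h
    have b1 : B1 := by tauto
    have h := hr2
    rw [← hsame (n - 1) (x - 1) (by omega) (by omega) (by omega) (by tauto),
      H' (n - 1) (x - 1) 0 (by omega) (by omega),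
      hsame 0 (x - 1) (by omega) (by omega) (by omega) (by omega),
      hA' 0 (x - 1) (n - x) (n - 1) (by omega) (by omega),
      ← col1 (n - x) (by omega),
      H' (n - x) (n - 1) (x - 1) (by omega) (by omega),
      col1 (x - 1) (by omega),
      hA' (x - 1) (n - 1) 0 (n - x) (by omega) (by omega),
      ← row0 (n - x) (by omega) (by omega),
      H' 0 (n - x) (n - 1) (by omega) (by omega),
      hsame (n - 1) (n - x) (by omega) (by omega) (by omega) (by tauto),
      hA' (n - 1) (n - x) (x - 1) 0 (by omega) (by omega)] at h
    have hle : x - 1 ≤ n - x := by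
      by_contra hc
      exact hr1c (x - 1) (by omega) (by omega) h
    have k := hB1 b1
    rw [H' (n - x + 1) 0 (x - 2) (by omega) (by omega),
      hsame (x - 2) 0 (by omega) (by omega) (by omega) (by tauto),
      hA' (x - 2) 0 (n - 1) (n + 1 - x) (by omega) (by omega),
      ← hsame (n - 1) (n + 1 - x) (by omega) (by omega) (by omega) (by tauto),
      H' (n - 1) (n + 1 - x) 0 (by omega) (by omega)] at k
    exact c1' k
  · intro H
    have H' : ∀ i j j', j + j' = n - 1 → i < n → (F' i j ↔ F' i j') := by
      intro i j j' h1 h2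
      rw [H i j h2 (by omega), show n - 1 - j = j' by omega]
    have hn1 : ¬ B1 := by
      intro b
      have h := hB1 b
      by_cases hx : x = 2
      · subst hx
        rw [H' (n - 2 + 1) 0 (n - 1) (by omega) (by omega),
          hsame (n - 2 + 1) (n - 1) (by omega) (by omega) (by omega) (by omega),
          hA' (n - 2 + 1) (n - 1) 0 0 (by omega) (by omega),
          ← hsame 0 0 (by omega) (by omega) (by omega) (by omega),
          H' 0 0 (n - 1) (by omega) (by omega)] at h
        exact c2' h
      rw [H' (n - x + 1) 0 (n - 1) (by omega) (by omega),
        col1 (n - x + 1) (by omega),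
        hA' (n - x + 1) (n - 1) 0 (x - 2) (by omega) (by omega),
        ← row0 (x - 2) (by omega) (by omega),
        H' 0 (x - 2) (n + 1 - x) (by omega) (by omega)] at h
      exact c1' h
    have b2 : B2 := by tauto
    have h := hr1
    rw [← hsame (n - x) 0 (by omega) (by omega) (by tauto) (by omega),
      H' (n - x) 0 (n - 1) (by omega) (by omega),
      col1 (n - x) (by omega),
      hA' (n - x) (n - 1) 0 (x - 1) (by omega) (by omega),
      ← row0 (x - 1) (by omega) (by omega),
      H' 0 (x - 1) (n - x) (by omega) (by omega),
      row0 (n - x) (by omega) (by omega),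
      hA' 0 (n - x) (x - 1) (n - 1) (by omega) (by omega),
      ← col1 (x - 1) (by omega),
      H' (x - 1) (n - 1) 0 (by omega) (by omega),
      hsame (x - 1) 0 (by omega) (by omega) (by tauto) (by omega)] at h
    have hle : x - 1 ≤ n - x := by
      by_contra hc
      exact hr1c (x - 1) (by omega) (by omega) h
    have k := hB2 b2
    rw [H' (n - 1) (x - 2) (n + 1 - x) (by omega) (by omega),
      hsame (n - 1) (n + 1 - x) (by omega) (by omega) (by tauto) (by omega),
      hA' (n - 1) (n + 1 - x) (x - 2) 0 (by omega) (by omega),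
      ← hsame (x - 2) 0 (by omega) (by omega) (by tauto) (by omega),
      H' (x - 2) 0 (n - 1) (by omega) (by omega)] at k
    exact c2' k
  · intro H
    rcases hB with b | b
    · have h := hB1 b
      rw [H _ _ (by omega) (by omega), show n - 1 - (n - x + 1) = x - 2 by omega] at h
      exact c2' h
    · have h := hB2 b
      rw [H _ _ (by omega) (by omega), show n - 1 - (x - 2) = n + 1 - x by omega,
        show n - 1 - (n - 1) = 0 by omega] at h
      exact c1' h
  · intro H
    have H' : ∀ i j j', i + j' = n - 1 → j < n → (F' i j ↔ F' j j') := by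
      intro i j j' h1 h2
      rw [H i j (by omega) h2, show n - 1 - i = j' by omega]
    rcases hB with b | b
    · have h := hB1 b
      rw [H' (n - x + 1) 0 (x - 2) (by omega) (by omega),
        H' 0 (x - 2) (n - 1) (by omega) (by omega)] at h
      exact c2' h
    · have h := hB2 b
      rw [H' (n - 1) (x - 2) 0 (by omega) (by omega),
        H' (x - 2) 0 (n + 1 - x) (by omega) (by omega)] at h
      exact c1' h
  · intro H
    have H' : ∀ i j i', j + i' = n - 1 → i < n → (F' i j ↔ F' i' i) := by
      intro i j j' h1 h2
      rw [H i j h2 (by omega), show n - 1 - j = j' by omega]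
    rcases hB with b | b
    · have h := hB1 b
      rw [H' (n - x + 1) 0 (n - 1) (by omega) (by omega),
        H' (n - 1) (n - x + 1) (x - 2) (by omega) (by omega)] at h
      exact c2' h
    · have h := hB2 b
      rw [H' (n - 1) (x - 2) (n + 1 - x) (by omega) (by omega),
        H' (n + 1 - x) (n - 1) 0 (by omega) (by omega),
        ] at h
      exact c1' (by simpa using h)

theorem zeroFirst_eq_aux {N : ℕ} (s : Fin N → Fin 3) (k0 : Fin N) (h0 : s k0 ≠ 0)
    (hz : ∀ j < k0, s j = 0) (k : Fin N) : zeroFirst s k = if k = k0 then 0 else s k := by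
  unfold zeroFirst
  by_cases hk : k = k0
  · subst hk
    rw [if_pos ⟨h0, hz⟩, if_pos rfl]
  · rw [if_neg hk, if_neg]
    rintro ⟨h1, h2⟩
    rcases lt_trichotomy k k0 with h | h | h
    · exact h1 (hz k h)
    · exact hk h
    · exact h0 (h2 k0 h)

theorem idx_lt_aux {n i j : ℕ} (hi : i < n) (hj : j < n) : n * j + i < n * n := by
  calc n * j + i < n * j + n := by omega
    _ = n * (j + 1) := by ring
    _ ≤ n * n := Nat.mul_le_mul_left n hj

theorem rowOf_idx_aux {n i j : ℕ} (hi : i < n) (hj : j < n) :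
    rowOf (⟨n * j + i, idx_lt_aux hi hj⟩ : Fin (n * n)) = ⟨i, hi⟩ := by
  simp [rowOf, Nat.mod_eq_of_lt hi]

theorem colOf_idx_aux {n i j : ℕ} (hi : i < n) (hj : j < n) :
    colOf (⟨n * j + i, idx_lt_aux hi hj⟩ : Fin (n * n)) = ⟨j, hj⟩ := by
  have hn : 0 < n := by omega
  simp [colOf, Nat.mul_add_div hn, Nat.div_eq_of_lt hi]

/-- value of `lamAD` at an explicit index -/
theorem lamAD_idx_aux {n i j : ℕ} (f : Fin n × Fin n → Fin 3) (hi : i < n) (hj : j < n) :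
    lamAD f ⟨n * j + i, idx_lt_aux hi hj⟩ = f (⟨n - 1 - i, by omega⟩, ⟨j, hj⟩) := by
  unfold lamAD
  rw [rowOf_idx_aux hi hj, colOf_idx_aux hi hj]
  congr 2
  ext; simp [Fin.val_rev]; omega

theorem lamAB_idx_aux {n i j : ℕ} (f : Fin n × Fin n → Fin 3) (hi : i < n) (hj : j < n) :
    lamAB f ⟨n * j + i, idx_lt_aux hi hj⟩ = f (⟨n - 1 - j, by omega⟩, ⟨i, hi⟩) := by
  unfold lamAB
  rw [rowOf_idx_aux hi hj, colOf_idx_aux hi hj]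
  congr 2
  ext; simp [Fin.val_rev]; omega

theorem lamCD_idx_aux {n i j : ℕ} (f : Fin n × Fin n → Fin 3) (hi : i < n) (hj : j < n) :
    lamCD f ⟨n * j + i, idx_lt_aux hi hj⟩ = f (⟨j, hj⟩, ⟨n - 1 - i, by omega⟩) := by
  unfold lamCD
  rw [rowOf_idx_aux hi hj, colOf_idx_aux hi hj]
  congr 2
  ext; simp [Fin.val_rev]; omega

theorem symA_of_reading_aux {n : ℕ} (f : Fin n × Fin n → Fin 3) (h : lamAD f = lamAB f) :
    f = f ∘ symA := by
  funext ⟨i, j⟩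
  have hi := i.2
  have := congrFun h ⟨n * j.val + (n - 1 - i.val), idx_lt_aux (by omega) j.2⟩
  rw [lamAD_idx_aux f (by omega) j.2, lamAB_idx_aux f (by omega) j.2] at this
  simp only [Function.comp, symA]
  convert this using 3
  · ext; simp; omega
  · ext; simp [Fin.val_rev]; omega
  · ext; simp [Fin.val_rev]; omega

theorem almost_symA_aux (n : ℕ) (f : Fin n × Fin n → Fin 3) (x y : ℕ) (hy2 : 2 ≤ y)
    (hyx : y ≤ x) (hxn : x ≤ n)
    (hn : 0 < n) (b1 : n - x < n) (b2 : n - 1 < n) (b3 : y - 1 < n)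
    (hr1 : f (⟨n - x, b1⟩, ⟨0, hn⟩) ≠ 0)
    (hr1c : ∀ i : Fin n, n - x < i.val → f (i, ⟨0, hn⟩) = 0)
    (hr2 : f (⟨n - 1, b2⟩, ⟨y - 1, b3⟩) ≠ 0)
    (hr2c : ∀ j : Fin n, j.val < y - 1 → f (⟨n - 1, b2⟩, j) = 0)
    (h : zeroFirst (lamAD f) = zeroFirst (lamAB f)) : f = f ∘ symA := by
  have hAD0 : ∀ i (hi : i < n), lamAD f ⟨i, by nlinarith⟩ =
      f (⟨n - 1 - i, by omega⟩, ⟨0, hn⟩) := by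
    intro i hi
    have := lamAD_idx_aux f hi hn
    simpa using this
  have hAB0 : ∀ i (hi : i < n), lamAB f ⟨i, by nlinarith⟩ =
      f (⟨n - 1, by omega⟩, ⟨i, hi⟩) := by
    intro i hi
    have := lamAB_idx_aux f hi hn
    simpa using this
  have z1 := zeroFirst_eq_aux (lamAD f) ⟨x - 1, by nlinarith [Nat.sub_le x 1, Nat.sub_lt (by omega : 0 < x) one_pos]⟩
    (by
      rw [hAD0 (x - 1) (by omega)]
      have e : n - 1 - (x - 1) = n - x := by omega
      simp only [e]
      exact hr1)
    (by
      rintro ⟨j, hj⟩ hlt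
      have hlt' : j < x - 1 := hlt
      rw [hAD0 j (by omega)]
      exact hr1c _ (by simp; omega))
  have z2 := zeroFirst_eq_aux (lamAB f) ⟨y - 1, by nlinarith [Nat.sub_le x 1, Nat.sub_lt (by omega : 0 < y) one_pos]⟩
    (by
      rw [hAB0 (y - 1) (by omega)]
      exact hr2)
    (by
      rintro ⟨j, hj⟩ hlt
      have hlt' : j < y - 1 := hlt
      rw [hAB0 j (by omega)]
      exact hr2c _ hlt')
  have hk := congrFun h ⟨n * (y - 1) + 0, idx_lt_aux hn (by omega)⟩
  have hge : n ≤ n * (y - 1) := Nat.le_mul_of_pos_right n (by omega)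
  rw [z1, z2, if_neg (by simp; omega), if_neg (by simp; omega),
    lamAD_idx_aux f hn (by omega), lamAB_idx_aux f hn (by omega)] at hk
  have hk0 : f (⟨n - 1 - (y - 1), by omega⟩, ⟨0, hn⟩) ≠ 0 := by
    rw [← hk]; exact hr2
  have hxy : x = y := by
    by_contra hne
    exact hk0 (hr1c _ (by simp; omega))
  subst hxy
  apply symA_of_reading_aux
  funext k
  have hkk := congrFun h k
  rw [z1, z2] at hkk
  by_cases he : k = ⟨x - 1, by nlinarith [Nat.sub_le x 1, Nat.sub_lt (by omega : 0 < x) one_pos]⟩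
  · rw [he, hAD0 (x - 1) (by omega), hAB0 (x - 1) (by omega)]
    exact hk.symm
  · rwa [if_neg he, if_neg he] at hkk

/-- Lemma 2.1 (part 1): in a configuration symmetric or almost symmetric of the second
type (largest corner D, second largest corner A), one move made by one or both of the
leading duo toward A does not create a partitive configuration. -/
theorem second_type_move_not_partitive (n : ℕ) (hn : 4 ≤ n) (hne : Even n)
    (f : Fin n × Fin n → Fin 3)
    (hf : SymSecondTypeA f ∨ AlmostSym2A f)
    (x y : ℕ) (hy2 : 2 ≤ y) (hyx : y ≤ x) (hxn : x ≤ n)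
    -- r₁ is the robot on side DA closest to A, at the x-th node from A
    (hr1 : f (⟨n - x, by omega⟩, ⟨0, by omega⟩) ≠ 0)
    (hr1c : ∀ i : Fin n, n - x < i.val → f (i, ⟨0, by omega⟩) = 0)
    -- r₂ is the robot on side AB closest to A, at the y-th node from A
    (hr2 : f (⟨n - 1, by omega⟩, ⟨y - 1, by omega⟩) ≠ 0)
    (hr2c : ∀ j : Fin n, j.val < y - 1 → f (⟨n - 1, by omega⟩, j) = 0)
    (f' : Fin n × Fin n → Fin 3)
    (hf' :
      f' = moveCfg f (⟨n - 1, by omega⟩, ⟨y - 1, by omega⟩) (⟨n - 1, by omega⟩, ⟨y - 2, by omega⟩) ∨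
      f' = moveCfg f (⟨n - x, by omega⟩, ⟨0, by omega⟩) (⟨n - x + 1, by omega⟩, ⟨0, by omega⟩) ∨
      f' = moveCfg (moveCfg f (⟨n - x, by omega⟩, ⟨0, by omega⟩) (⟨n - x + 1, by omega⟩, ⟨0, by omega⟩))
             (⟨n - 1, by omega⟩, ⟨y - 1, by omega⟩) (⟨n - 1, by omega⟩, ⟨y - 2, by omega⟩)) :
    ¬ PartitiveSq f' := by
  have hn0 : 0 < n := by omega
  have hkey : CornersEmpty f ∧ f = f ∘ symA ∧ SecondIsA f := by
    rcases hf with ⟨⟨h1, h2, _, _⟩, h3⟩ | ⟨h1, _, h2, _, h3, h4⟩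
    · exact ⟨h1, h2, h3⟩
    · exact absurd (almost_symA_aux n f x y hy2 hyx hxn hn0 (by omega) (by omega) (by omega) hr1 hr1c hr2 hr2c h4)
        (h2 symA (by simp))
  obtain ⟨hcor, hsym, hsec⟩ := hkey
  have hsym' : ∀ i j (hi : i < n) (hj : j < n), f (⟨i, hi⟩, ⟨j, hj⟩) =
      f (⟨n - 1 - j, by omega⟩, ⟨n - 1 - i, by omega⟩) := by
    intro i j hi hj
    have := congrFun hsym (⟨i, hi⟩, ⟨j, hj⟩)
    rw [this]
    simp only [Function.comp, symA]
    congr 2 <;> (ext; simp [Fin.val_rev]; omega)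
  have hxy : y = x := by
    by_contra hne
    apply hr2
    rw [hsym']
    have := hr1c ⟨n - 1 - (y - 1), by omega⟩ (by simp; omega)
    convert this using 4
    omega
  subst hxy
  have hyn : y < n := by
    by_contra hc
    exact hr1 (hcor _ (by simp; omega) (by simp))
  -- readings from `A` coincide, and both dominate the readings from `C`
  have hread : toLex (lamCD f) ≤ toLex (lamAB f) := by
    rcases hsec with h | h
    · have e : lamAD f = lamAB f := by
        funext k
        simp only [lamAD, lamAB]
        conv_lhs => rw [hsym]
        simp [Function.comp, symA]
      rw [← e]
      exact h _ (by simp)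
    · exact h _ (by simp)
  have h3 : ∀ j (hj : j < y - 1), f (⟨0, hn0⟩, ⟨n - 1 - j, by omega⟩) = 0 := by
    intro j hj
    have hjn : j < n := by omega
    have := lex_zero_aux _ _ hread ⟨n * 0 + j, idx_lt_aux hjn hn0⟩ (by
      rintro ⟨k, hk⟩ hle
      have hle' : k ≤ n * 0 + j := hle
      have hkn : k < n := by omega
      have e := lamAB_idx_aux f hkn hn0
      simp only [Nat.mul_zero, Nat.zero_add] at e
      rw [e]
      exact hr2c _ (by simp; omega))
    rwa [lamCD_idx_aux f hjn hn0] at this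
  have hw1 : f (⟨n - y + 1, by omega⟩, ⟨0, hn0⟩) = 0 := hr1c _ (by simp)
  have hw2 : f (⟨n - 1, by omega⟩, ⟨y - 2, by omega⟩) = 0 := hr2c _ (by simp; omega)
  have core := fun B1 B2 => core_aux n y hy2 hyn
    (fun i j => ∃ (hi : i < n) (hj : j < n), f (⟨i, hi⟩, ⟨j, hj⟩) ≠ 0)
    (fun i j => ∃ (hi : i < n) (hj : j < n), f' (⟨i, hi⟩, ⟨j, hj⟩) ≠ 0)
    (by
      rintro i j hi hj ⟨_, _, h⟩
      refine ⟨by omega, by omega, ?_⟩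
      rwa [← hsym'])
    (by
      rintro j hj ⟨_, _, h⟩
      exact h (h3 j hj))
    (by
      rintro i hi hlt ⟨_, _, h⟩
      exact h (hr1c _ hlt))
    ⟨by omega, by omega, hr1⟩ B1 B2
  have hne1 : (0 : Fin 3) + 1 ≠ 0 := by decide
  have hne2 : (0 : Fin 3) + 1 + 1 ≠ 0 := by decide
  have hex : ∃ B1 B2 : Prop, (B1 ∨ B2) ∧
      (B1 → ∃ (hi : n - y + 1 < n) (hj : 0 < n), f' (⟨n - y + 1, hi⟩, ⟨0, hj⟩) ≠ 0) ∧
      (B2 → ∃ (hi : n - 1 < n) (hj : y - 2 < n), f' (⟨n - 1, hi⟩, ⟨y - 2, hj⟩) ≠ 0) ∧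
      (∀ (i j : ℕ), i < n → j < n →
        ¬(B1 ∧ j = 0 ∧ (i = n - y ∨ i = n - y + 1)) →
        ¬(B2 ∧ i = n - 1 ∧ (j = y - 1 ∨ j = y - 2)) →
        ((∃ (hi : i < n) (hj : j < n), f' (⟨i, hi⟩, ⟨j, hj⟩) ≠ 0) ↔
          ∃ (hi : i < n) (hj : j < n), f (⟨i, hi⟩, ⟨j, hj⟩) ≠ 0)) := by
    rcases hf' with hf' | hf' | hf'
    · refine ⟨False, True, Or.inr trivial, fun h => h.elim,
        fun _ => ⟨by omega, by omega, by
          rw [hf', moveCfg, if_neg (by simp; omega), if_pos rfl, hw2]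
          exact hne1⟩,
        by
          intro i j hi hj ha hb
          have : f' (⟨i, hi⟩, ⟨j, hj⟩) = f (⟨i, hi⟩, ⟨j, hj⟩) := by
            rw [hf', moveCfg, if_neg (by simp only [Prod.mk.injEq, Fin.mk.injEq]; rintro ⟨e1, e2⟩; first | exact hb ⟨trivial, e1, Or.inl e2⟩ | exact hb ⟨trivial, e1, Or.inr e2⟩ | exact ha ⟨trivial, e2, Or.inl e1⟩ | exact ha ⟨trivial, e2, Or.inr e1⟩), if_neg (by simp only [Prod.mk.injEq, Fin.mk.injEq]; rintro ⟨e1, e2⟩; first | exact hb ⟨trivial, e1, Or.inl e2⟩ | exact hb ⟨trivial, e1, Or.inr e2⟩ | exact ha ⟨trivial, e2, Or.inl e1⟩ | exact ha ⟨trivial, e2, Or.inr e1⟩)]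
          simp only [this]⟩
    · refine ⟨True, False, Or.inl trivial,
        fun _ => ⟨by omega, by omega, by
          rw [hf', moveCfg, if_neg (by simp), if_pos rfl, hw1]
          exact hne1⟩,
        fun h => h.elim,
        by
          intro i j hi hj ha hb
          have : f' (⟨i, hi⟩, ⟨j, hj⟩) = f (⟨i, hi⟩, ⟨j, hj⟩) := by
            rw [hf', moveCfg, if_neg (by simp only [Prod.mk.injEq, Fin.mk.injEq]; rintro ⟨e1, e2⟩; first | exact hb ⟨trivial, e1, Or.inl e2⟩ | exact hb ⟨trivial, e1, Or.inr e2⟩ | exact ha ⟨trivial, e2, Or.inl e1⟩ | exact ha ⟨trivial, e2, Or.inr e1⟩), if_neg (by simp only [Prod.mk.injEq, Fin.mk.injEq]; rintro ⟨e1, e2⟩; first | exact hb ⟨trivial, e1, Or.inl e2⟩ | exact hb ⟨trivial, e1, Or.inr e2⟩ | exact ha ⟨trivial, e2, Or.inl e1⟩ | exact ha ⟨trivial, e2, Or.inr e1⟩)]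
          simp only [this]⟩
    · refine ⟨True, True, Or.inl trivial,
        fun _ => ⟨by omega, by omega, by
          rw [hf', moveCfg, if_neg (by simp; omega)]
          split_ifs with hc
          · obtain ⟨hc1, hc2⟩ := Prod.mk.inj hc
            have hv2 : 0 = y - 2 := Fin.mk.inj hc2
            rw [← hc, moveCfg, if_neg (by simp), if_pos rfl, hw1]
            exact hne2
          · rw [moveCfg, if_neg (by simp), if_pos rfl, hw1]
            exact hne1⟩,
        fun _ => ⟨by omega, by omega, by
          rw [hf', moveCfg, if_neg (by simp; omega), if_pos rfl, moveCfg,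
            if_neg (by simp; omega)]
          split_ifs with hc
          · rw [hw1]
            exact hne2
          · rw [hw2]
            exact hne1⟩,
        by
          intro i j hi hj ha hb
          have : f' (⟨i, hi⟩, ⟨j, hj⟩) = f (⟨i, hi⟩, ⟨j, hj⟩) := by
            rw [hf', moveCfg, if_neg (by simp only [Prod.mk.injEq, Fin.mk.injEq]; rintro ⟨e1, e2⟩; first | exact hb ⟨trivial, e1, Or.inl e2⟩ | exact hb ⟨trivial, e1, Or.inr e2⟩ | exact ha ⟨trivial, e2, Or.inl e1⟩ | exact ha ⟨trivial, e2, Or.inr e1⟩), if_neg (by simp only [Prod.mk.injEq, Fin.mk.injEq]; rintro ⟨e1, e2⟩; first | exact hb ⟨trivial, e1, Or.inl e2⟩ | exact hb ⟨trivial, e1, Or.inr e2⟩ | exact ha ⟨trivial, e2, Or.inl e1⟩ | exact ha ⟨trivial, e2, Or.inr e1⟩), moveCfg,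
              if_neg (by simp only [Prod.mk.injEq, Fin.mk.injEq]; rintro ⟨e1, e2⟩; first | exact hb ⟨trivial, e1, Or.inl e2⟩ | exact hb ⟨trivial, e1, Or.inr e2⟩ | exact ha ⟨trivial, e2, Or.inl e1⟩ | exact ha ⟨trivial, e2, Or.inr e1⟩), if_neg (by simp only [Prod.mk.injEq, Fin.mk.injEq]; rintro ⟨e1, e2⟩; first | exact hb ⟨trivial, e1, Or.inl e2⟩ | exact hb ⟨trivial, e1, Or.inr e2⟩ | exact ha ⟨trivial, e2, Or.inl e1⟩ | exact ha ⟨trivial, e2, Or.inr e1⟩)]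
          simp only [this]⟩
  obtain ⟨B1, B2, q1, q2, q3, q4⟩ := hex
  have hall := core B1 B2 q1 q2 q3 q4
  obtain ⟨c1, c2, c3, c4, c5⟩ := hall
  have hrev : ∀ i (hi : i < n), (⟨i, hi⟩ : Fin n).rev = ⟨n - 1 - i, by omega⟩ := by
    intro i hi
    ext; simp [Fin.val_rev]; omega
  rintro ⟨σ, hσ, hinv⟩
  simp only [List.mem_cons, List.not_mem_nil, or_false] at hσ
  have hinv' : ∀ i j (hi : i < n) (hj : j < n), f' (⟨i, hi⟩, ⟨j, hj⟩) =
      f' (σ (⟨i, hi⟩, ⟨j, hj⟩)) := fun i j hi hj => congrFun hinv _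
  rcases hσ with h | h | h | h | h <;> subst h
  · apply c1
    intro i j hi hj
    have := hinv' i j hi hj
    simp only [symH, hrev] at this
    have hi2 : n - 1 - i < n := by omega
    simp only [hi, hj, hi2, this, exists_true_left]
  · apply c2
    intro i j hi hj
    have := hinv' i j hi hj
    simp only [symV, hrev] at this
    have hi2 : n - 1 - j < n := by omega
    simp only [hi, hj, hi2, this, exists_true_left]
  · apply c4
    intro i j hi hj
    have := hinv' i j hi hj
    simp only [symR1, hrev] at this
    have hi2 : n - 1 - i < n := by omega
    simp only [hi, hj, hi2, this, exists_true_left]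
  · apply c5
    intro i j hi hj
    have := hinv' i j hi hj
    simp only [symR1inv, hrev] at this
    have hi2 : n - 1 - j < n := by omega
    simp only [hi, hj, hi2, this, exists_true_left]
  · apply c3
    intro i j hi hj
    have := hinv' i j hi hj
    simp only [symR2, hrev] at this
    have hi2 : n - 1 - j < n := by omega
    have hi3 : n - 1 - i < n := by omega
    simp only [hi, hj, hi2, hi3, this, exists_true_left]
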